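/- arXiv:2202.00854 — 5 statements merged into one kernel-verified Lean document; each statement's English description precedes it below -/
import Mathlib

section
/- If a proper circular-arc graph G is not connected, then G is a proper interval graph. -/
/-! Common definitions: arc/interval representations, graph classes,
induced subgraph containment, small named graphs, reduced graphs. -/

/-- The point of the unit circle corresponding to parameter `t`. -/
noncomputable def circlePt (t : ℝ) : ℝ × ℝ :=
  (Real.cos (2 * Real.pi * t), Real.sin (2 * Real.pi * t))

/-- A (nonempty closed) arc of the unit circle: the image under
`t ↦ (cos 2πt, sin 2πt)` of a closed interval `[a, b] ⊆ ℝ` with `0 ≤ b - a < 1`. -/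
def IsUnitCircleArc (A : Set (ℝ × ℝ)) : Prop :=
  ∃ a b : ℝ, 0 ≤ b - a ∧ b - a < 1 ∧ A = circlePt '' Set.Icc a b

/-- An arc representation of a graph: each vertex gets an arc of the unit circle,
and two distinct vertices are adjacent iff their arcs intersect. -/
def IsArcRep {V : Type*} (G : SimpleGraph V) (f : V → Set (ℝ × ℝ)) : Prop :=
  (∀ v, IsUnitCircleArc (f v)) ∧
    ∀ u v : V, u ≠ v → (G.Adj u v ↔ (f u ∩ f v).Nonempty)

/-- A family of sets is proper if no member is properly contained in another. -/
def ProperFamily {V α : Type*} (f : V → Set α) : Prop :=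
  ∀ u v : V, ¬ f u ⊂ f v

/-- A family of sets is Helly if every subfamily of pairwise intersecting sets
has a common point. -/
def HellyFamily {V α : Type*} (f : V → Set α) : Prop :=
  ∀ S : Set V, (∀ u ∈ S, ∀ v ∈ S, (f u ∩ f v).Nonempty) → (⋂ v ∈ S, f v).Nonempty

/-- A proper circular-arc graph: admits an arc representation with no arc
properly contained in another. -/
def IsProperCircularArcGraph {V : Type*} (G : SimpleGraph V) : Prop :=
  ∃ f : V → Set (ℝ × ℝ), IsArcRep G f ∧ ProperFamily f

/-- A proper Helly circular-arc graph: admits an arc representation that is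
simultaneously proper and Helly. -/
def IsProperHellyCircularArcGraph {V : Type*} (G : SimpleGraph V) : Prop :=
  ∃ f : V → Set (ℝ × ℝ), IsArcRep G f ∧ ProperFamily f ∧ HellyFamily f

/-- An interval representation: each vertex gets a nonempty closed bounded
interval of ℝ; distinct vertices adjacent iff intervals intersect. -/
def IsIntervalRep {V : Type*} (G : SimpleGraph V) (f : V → Set ℝ) : Prop :=
  (∀ v, ∃ a b : ℝ, a ≤ b ∧ f v = Set.Icc a b) ∧
    ∀ u v : V, u ≠ v → (G.Adj u v ↔ (f u ∩ f v).Nonempty)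

def IsIntervalGraph {V : Type*} (G : SimpleGraph V) : Prop :=
  ∃ f : V → Set ℝ, IsIntervalRep G f

def IsProperIntervalGraph {V : Type*} (G : SimpleGraph V) : Prop :=
  ∃ f : V → Set ℝ, IsIntervalRep G f ∧ ProperFamily f

/-- A graph is bipartite: its vertices can be partitioned into two independent sets. -/
def IsBipartite {V : Type*} (G : SimpleGraph V) : Prop :=
  ∃ c : V → Bool, ∀ u v : V, G.Adj u v → c u ≠ c v

/-- A permutation graph. -/
def IsPermutationGraph {V : Type*} (G : SimpleGraph V) : Prop :=
  ∃ a b : V → ℝ, Function.Injective a ∧ Function.Injective b ∧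
    ∀ u v : V, u ≠ v → (G.Adj u v ↔ (a u - a v) * (b u - b v) < 0)

def IsBipartitePermutationGraph {V : Type*} (G : SimpleGraph V) : Prop :=
  IsPermutationGraph G ∧ IsBipartite G

/-- `f : ZMod ℓ → V` is an induced (chordless) cycle of length `ℓ ≥ 3` in `G`:
`f` is injective and two images are adjacent iff their indices are consecutive mod `ℓ`. -/
def IsInducedCycle {V : Type*} (G : SimpleGraph V) (ℓ : ℕ) (f : ZMod ℓ → V) : Prop :=
  3 ≤ ℓ ∧ Function.Injective f ∧
    ∀ i j : ZMod ℓ, G.Adj (f i) (f j) ↔ (i = j + 1 ∨ j = i + 1)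

/-- `G` contains `H` as an induced subgraph. -/
def ContainsInduced {V W : Type*} (G : SimpleGraph V) (H : SimpleGraph W) : Prop :=
  ∃ f : W → V, Function.Injective f ∧ ∀ u v : W, H.Adj u v ↔ G.Adj (f u) (f v)

/-- `G` contains `C_ℓ*`: an induced cycle of length `ℓ` together with a vertex
adjacent to no vertex of the cycle. -/
def HasCycleStar {V : Type*} (G : SimpleGraph V) (ℓ : ℕ) : Prop :=
  ∃ (f : ZMod ℓ → V) (v : V), IsInducedCycle G ℓ f ∧ ∀ i : ZMod ℓ, ¬ G.Adj v (f i)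

/-- A maximal clique. -/
def IsMaxClique {V : Type*} (G : SimpleGraph V) (s : Set V) : Prop :=
  G.IsClique s ∧ ∀ t : Set V, G.IsClique t → s ⊆ t → t = s

/-- A clique path: a linear arrangement of all maximal cliques of `G` such that
the cliques containing any fixed vertex are consecutive. -/
def IsCliquePath {W : Type*} (G : SimpleGraph W) (q : ℕ) (K : Fin q → Set W) : Prop :=
  Function.Injective K ∧ (∀ i, IsMaxClique G (K i)) ∧
    (∀ s : Set W, IsMaxClique G s → ∃ i, K i = s) ∧
    ∀ (v : W) (i j k : Fin q), i ≤ j → j ≤ k → v ∈ K i → v ∈ K k → v ∈ K j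

/-- A circular interval of residues mod `n`: `{p, p+1, …, p+m}`. -/
def IsCircInterval {n : ℕ} (s : Set (ZMod n)) : Prop :=
  ∃ (p : ZMod n) (m : ℕ), s = {x : ZMod n | ∃ k : ℕ, k ≤ m ∧ x = p + (k : ZMod n)}

/-! ### Small named graphs -/

/-- The claw `K_{1,3}`. -/
def clawG : SimpleGraph (Fin 4) := SimpleGraph.fromRel (fun u _ => u = 0)

/-- The net: a triangle `{0,1,2}` with pendant vertices `3,4,5` attached to
`0,1,2` respectively. -/
def netG : SimpleGraph (Fin 6) :=
  SimpleGraph.fromRel (fun u v => (u.val < 3 ∧ v.val < 3) ∨ v.val = u.val + 3)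

/-- The tent `S_3`: triangle `{0,1,2}`, independent set `{3,4,5}`, with
`3 ~ 0,1`, `4 ~ 1,2`, `5 ~ 2,0`. -/
def tentS3 : SimpleGraph (Fin 6) :=
  SimpleGraph.fromRel (fun u v =>
    (u.val < 3 ∧ v.val < 3) ∨ (u = 3 ∧ (v = 0 ∨ v = 1)) ∨
      (u = 4 ∧ (v = 1 ∨ v = 2)) ∨ (u = 5 ∧ (v = 2 ∨ v = 0)))

/-- `S_3*`: the tent together with an isolated vertex `6`. -/
def S3star : SimpleGraph (Fin 7) :=
  SimpleGraph.fromRel (fun u v =>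
    (u.val < 3 ∧ v.val < 3) ∨ (u = 3 ∧ (v = 0 ∨ v = 1)) ∨
      (u = 4 ∧ (v = 1 ∨ v = 2)) ∨ (u = 5 ∧ (v = 2 ∨ v = 0)))

/-- The complement of `S_3*`. -/
def compS3star : SimpleGraph (Fin 7) := S3starᶜ

/-- The complement of `C_4*`: two edges `0-2`, `1-3` plus a universal vertex `4`. -/
def compC4star : SimpleGraph (Fin 5) :=
  SimpleGraph.fromRel (fun u v => (u = 0 ∧ v = 2) ∨ (u = 1 ∧ v = 3) ∨ u = 4)

/-- The chordless cycle `C_6`. -/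
def cycle6G : SimpleGraph (Fin 6) :=
  SimpleGraph.fromRel (fun u v => v.val = (u.val + 1) % 6)

/-- The complement of `C_6`. -/
def compC6 : SimpleGraph (Fin 6) := cycle6Gᶜ

/-- The wheel `W_4`: a `C_4` on `{0,1,2,3}` plus a hub `4`. -/
def W4G : SimpleGraph (Fin 5) :=
  SimpleGraph.fromRel (fun u v => (u.val < 4 ∧ v.val = (u.val + 1) % 4) ∨ v = 4)

/-- The wheel `W_5`: a `C_5` on `{0,…,4}` plus a hub `5`. -/
def W5G : SimpleGraph (Fin 6) :=
  SimpleGraph.fromRel (fun u v => (u.val < 5 ∧ v.val = (u.val + 1) % 5) ∨ v = 5)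

/-- `F_1` (the long claw): the claw with each edge subdivided once. -/
def F1G : SimpleGraph (Fin 7) :=
  SimpleGraph.fromRel (fun u v =>
    (u = 0 ∧ v = 1) ∨ (u = 1 ∧ v = 2) ∨ (u = 0 ∧ v = 3) ∨ (u = 3 ∧ v = 4) ∨
      (u = 0 ∧ v = 5) ∨ (u = 5 ∧ v = 6))

/-- `F_2`: a `C_4` `0-1-2-3-0` with pendant vertices `4,5,6` attached to `0,2,3`. -/
def F2G : SimpleGraph (Fin 7) :=
  SimpleGraph.fromRel (fun u v =>
    (u = 0 ∧ v = 1) ∨ (u = 1 ∧ v = 2) ∨ (u = 2 ∧ v = 3) ∨ (u = 3 ∧ v = 0) ∨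
      (u = 0 ∧ v = 4) ∨ (u = 2 ∧ v = 5) ∨ (u = 3 ∧ v = 6))

/-- `F_3`: a `C_6` `0-1-2-3-4-5-0` with chord `0-3` and pendant `6` at `0`. -/
def F3G : SimpleGraph (Fin 7) :=
  SimpleGraph.fromRel (fun u v =>
    (u.val < 6 ∧ v.val = (u.val + 1) % 6) ∨ (u = 0 ∧ v = 3) ∨ (u = 0 ∧ v = 6))

/-- `F_4`: a `C_6` `0-1-2-3-4-5-0` with chord `0-3` and a vertex `6` adjacent
exactly to `0` and `3`. -/
def F4G : SimpleGraph (Fin 7) :=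
  SimpleGraph.fromRel (fun u v =>
    (u.val < 6 ∧ v.val = (u.val + 1) % 6) ∨ (u = 0 ∧ v = 3) ∨ (u = 6 ∧ (v = 0 ∨ v = 3)))

/-- A reduced graph: connected, co-connected, and containing none of
`C_3*`, `C_5*`, the complement of `C_4*`, `C_6`, `S_3`, the complement of `S_3*`,
`F_1`, `F_2`, `F_3`, `F_4` as induced subgraphs. -/
def IsReducedGraph {V : Type*} (R : SimpleGraph V) : Prop :=
  R.Connected ∧ Rᶜ.Connected ∧
    ¬ HasCycleStar R 3 ∧ ¬ HasCycleStar R 5 ∧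
    ¬ ContainsInduced R compC4star ∧
    ¬ (∃ f : ZMod 6 → V, IsInducedCycle R 6 f) ∧
    ¬ ContainsInduced R tentS3 ∧
    ¬ ContainsInduced R compS3star ∧
    ¬ ContainsInduced R F1G ∧ ¬ ContainsInduced R F2G ∧
    ¬ ContainsInduced R F3G ∧ ¬ ContainsInduced R F4G

theorem continuous_circlePt : Continuous circlePt := by
  unfold circlePt
  fun_prop

theorem circlePt_sub_int (t : ℝ) (n : ℤ) : circlePt (t - n) = circlePt t := by
  have h : 2 * Real.pi * (t - n) = 2 * Real.pi * t - n * (2 * Real.pi) := by ring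
  simp only [circlePt, h, Real.cos_sub_int_mul_two_pi, Real.sin_sub_int_mul_two_pi]

theorem injOn_circlePt (p : ℝ) : Set.InjOn circlePt (Set.Ico p (p + 1)) := by
  intro s hs t ht h
  obtain ⟨hc, hsin⟩ := Prod.ext_iff.1 h
  obtain ⟨k, hk⟩ := Real.Angle.angle_eq_iff_two_pi_dvd_sub.1 (Real.Angle.cos_sin_inj hc hsin)
  have hst : s - t = k := by
    have : 2 * Real.pi * (s - t) = 2 * Real.pi * k := by linarith
    exact mul_left_cancel₀ (by positivity) this
  have h₁ : (k : ℝ) < 1 := by linarith [hs.2, ht.1]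
  have h₂ : (-1 : ℝ) < k := by linarith [hs.1, ht.2]
  have hk0 : k = 0 := by
    have h₃ : k < 1 := by exact_mod_cast h₁
    have h₄ : -1 < k := by exact_mod_cast h₂
    omega
  rw [hk0, Int.cast_zero] at hst
  linarith

theorem IsUnitCircleArc.isClosed {A : Set (ℝ × ℝ)} (hA : IsUnitCircleArc A) : IsClosed A := by
  obtain ⟨a, b, -, -, rfl⟩ := hA
  exact (isCompact_Icc.image continuous_circlePt).isClosed

theorem IsUnitCircleArc.exists_preimage_nonempty {A : Set (ℝ × ℝ)} (hA : IsUnitCircleArc A) :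
    ∃ t, circlePt t ∈ A := by
  obtain ⟨a, b, hab, -, rfl⟩ := hA
  exact ⟨a, a, ⟨le_rfl, by linarith⟩, rfl⟩

/-- An arc avoiding `circlePt p` lifts to an interval inside the period starting at `p`. -/
theorem IsUnitCircleArc.exists_lift {A : Set (ℝ × ℝ)} (hA : IsUnitCircleArc A) {p : ℝ}
    (hp : circlePt p ∉ A) :
    ∃ a b : ℝ, a ≤ b ∧ Set.Icc a b ⊆ Set.Ico p (p + 1) ∧ A = circlePt '' Set.Icc a b := by
  obtain ⟨a, b, hab, -, rfl⟩ := hA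
  have h₁ := Int.floor_le (a - p)
  have h₂ := Int.lt_floor_add_one (a - p)
  have hb : b - ⌊a - p⌋ < p + 1 := by
    by_contra! hb
    refine hp ⟨p + 1 + ⌊a - p⌋, ⟨by linarith, by linarith⟩, ?_⟩
    have h := circlePt_sub_int (p + 1 + ⌊a - p⌋) (⌊a - p⌋ + 1)
    rw [← h]
    congr 1
    push_cast
    ring
  refine ⟨a - ⌊a - p⌋, b - ⌊a - p⌋, by linarith, fun x hx => ⟨?_, ?_⟩, ?_⟩
  · linarith [hx.1]
  · linarith [hx.2]
  · rw [← Set.image_sub_const_Icc, Set.image_image]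
    exact Set.image_congr fun x _ => (circlePt_sub_int x _).symm

theorem exists_circlePt_notMem_of_not_connected {V : Type*} [Finite V] [Nonempty V]
    {G : SimpleGraph V} (hG : ¬ G.Connected) {f : V → Set (ℝ × ℝ)} (hf : IsArcRep G f) :
    ∃ p, ∀ v, circlePt p ∉ f v := by
  have hpre : ¬ G.Preconnected := fun h => hG ⟨h⟩
  simp only [SimpleGraph.Preconnected, not_forall] at hpre
  obtain ⟨x, y, hxy⟩ := hpre
  let S : Set V := {v | G.Reachable x v}
  have hclosed (T : Set V) : IsClosed (circlePt ⁻¹' ⋃ v ∈ T, f v) :=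
    ((Set.toFinite T).isClosed_biUnion fun v _ => (hf.1 v).isClosed).preimage
      continuous_circlePt
  by_contra! hcover
  obtain ⟨s, hs⟩ := (hf.1 x).exists_preimage_nonempty
  obtain ⟨t, ht⟩ := (hf.1 y).exists_preimage_nonempty
  obtain ⟨r, -, hr₁, hr₂⟩ := isPreconnected_closed_iff.1 isPreconnected_univ _ _
    (hclosed S) (hclosed Sᶜ)
    (fun r _ => by
      obtain ⟨v, hv⟩ := hcover r
      by_cases hvS : v ∈ S
      · exact Or.inl (Set.mem_biUnion hvS hv)
      · exact Or.inr (Set.mem_biUnion hvS hv))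
    ⟨s, trivial, Set.mem_biUnion (SimpleGraph.Reachable.refl x : x ∈ S) hs⟩
    ⟨t, trivial, Set.mem_biUnion (hxy : y ∈ Sᶜ) ht⟩
  simp only [Set.mem_preimage, Set.mem_iUnion] at hr₁ hr₂
  obtain ⟨u, hu, hru⟩ := hr₁
  obtain ⟨v, hv, hrv⟩ := hr₂
  have huv : u ≠ v := fun h => hv (h ▸ hu)
  have hadj : G.Adj u v := (hf.2 u v huv).2 ⟨_, hru, hrv⟩
  exact hv (SimpleGraph.Reachable.trans hu hadj.reachable)

/-- If a proper circular-arc graph `G` is not connected, then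
`G` is a proper interval graph. -/
theorem pcag_disconnected_is_proper_interval {V : Type*} [Fintype V] (G : SimpleGraph V)
    (hpcag : IsProperCircularArcGraph G) (hdisc : ¬ G.Connected) :
    IsProperIntervalGraph G := by
  obtain ⟨f, hf, hproper⟩ := hpcag
  rcases isEmpty_or_nonempty V with hV | hV
  · exact ⟨fun _ => ∅, ⟨isEmptyElim, isEmptyElim⟩, isEmptyElim⟩
  obtain ⟨p, hp⟩ := exists_circlePt_notMem_of_not_connected hdisc hf
  choose a b hab hsub himage using fun v => (hf.1 v).exists_lift (hp v)
  refine ⟨fun v => Set.Icc (a v) (b v), ⟨fun v => ⟨a v, b v, hab v, rfl⟩, fun u v huv => ?_⟩,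
    fun u v huv => hproper u v ?_⟩
  · rw [hf.2 u v huv, himage u, himage v, ← (injOn_circlePt p).image_inter (hsub u) (hsub v),
      Set.image_nonempty]
  · rw [himage u, himage v]
    exact ((injOn_circlePt p).image_ssubset_image_iff (hsub u) (hsub v)).2 huv
end

section
/- Let G be a connected graph that contains neither the claw nor the net as an induced subgraph. Then for every ℓ ≥ 5, G does not contain C_ℓ* as an induced subgraph; equivalently, for every induced cycle C of G of length at least 5 and every vertex v of G, either v lies on C or v has a neighbor on C. -/
theorem containsInduced_claw {V : Type*} {G : SimpleGraph V} {a b c d : V}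
    (hab : G.Adj a b) (hac : G.Adj a c) (had : G.Adj a d)
    (hbc : b ≠ c) (hbd : b ≠ d) (hcd : c ≠ d)
    (nbc : ¬ G.Adj b c) (nbd : ¬ G.Adj b d) (ncd : ¬ G.Adj c d) :
    ContainsInduced G clawG := by
  refine ⟨![a, b, c, d], ?_, ?_⟩
  · have := hab.ne
    have := hac.ne
    have := had.ne
    intro i j hij
    fin_cases i <;> fin_cases j <;> simp_all
  · intro i j
    fin_cases i <;> fin_cases j <;> simp_all [clawG, G.adj_comm]

theorem containsInduced_net {V : Type*} {G : SimpleGraph V} {a b c x y z : V}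
    (hab : G.Adj a b) (hac : G.Adj a c) (hbc : G.Adj b c)
    (hax : G.Adj a x) (hby : G.Adj b y) (hcz : G.Adj c z)
    (nay : ¬ G.Adj a y) (naz : ¬ G.Adj a z) (nbx : ¬ G.Adj b x) (nbz : ¬ G.Adj b z)
    (ncx : ¬ G.Adj c x) (ncy : ¬ G.Adj c y)
    (nxy : ¬ G.Adj x y) (nxz : ¬ G.Adj x z) (nyz : ¬ G.Adj y z) :
    ContainsInduced G netG := by
  refine ⟨![a, b, c, x, y, z], ?_, ?_⟩
  · intro i j hij
    fin_cases i <;> fin_cases j <;> first | rfl | (exfalso; simp at hij; grind [G.adj_comm, G.irrefl])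
  · intro i j
    fin_cases i <;> fin_cases j <;> simp [netG] <;> grind [G.adj_comm, G.irrefl]

/-- A nonzero natural number below `ℓ` is nonzero in `ZMod ℓ`. -/
theorem ZMod.natCast_ne_zero_of_lt {ℓ k : ℕ} (hk : k ≠ 0) (hkℓ : k < ℓ) :
    (k : ZMod ℓ) ≠ 0 := by
  rw [Ne, ZMod.natCast_eq_zero_iff]
  exact fun h => absurd (Nat.le_of_dvd (Nat.pos_of_ne_zero hk) h) (by omega)

/-- In a claw-free and net-free graph, domination by a long induced cycle propagates along
edges. -/
theorem exists_adj_inducedCycle_of_adj {V : Type*} {G : SimpleGraph V}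
    (hclaw : ¬ ContainsInduced G clawG) (hnet : ¬ ContainsInduced G netG)
    {ℓ : ℕ} {f : ZMod ℓ → V} (hℓ : 5 ≤ ℓ) (hf : IsInducedCycle G ℓ f)
    {u w : V} (hu : u ∈ Set.range f ∨ ∃ i, G.Adj u (f i)) (huw : G.Adj u w) :
    w ∈ Set.range f ∨ ∃ i, G.Adj w (f i) := by
  obtain ⟨-, hinj, hadj⟩ := hf
  by_contra! hw
  obtain ⟨hwf, hw⟩ := hw
  have hwne (i) : f i ≠ w := fun h => hwf ⟨i, h⟩
  have hw' (i) : ¬ G.Adj (f i) w := fun h => hw i h.symm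
  have huf : u ∉ Set.range f := by
    rintro ⟨i, rfl⟩
    exact hw i huw.symm
  have hune (i) : f i ≠ u := fun h => huf ⟨i, h⟩
  obtain ⟨i, hi⟩ := hu.resolve_left huf
  have h1 : (1 : ZMod ℓ) ≠ 0 := mod_cast ZMod.natCast_ne_zero_of_lt (k := 1) (by decide) (by omega)
  have h2 : (2 : ZMod ℓ) ≠ 0 := mod_cast ZMod.natCast_ne_zero_of_lt (k := 2) (by decide) (by omega)
  have h3 : (3 : ZMod ℓ) ≠ 0 := mod_cast ZMod.natCast_ne_zero_of_lt (k := 3) (by decide) (by omega)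
  have h4 : (4 : ZMod ℓ) ≠ 0 := mod_cast ZMod.natCast_ne_zero_of_lt (k := 4) (by decide) (by omega)
  have hsucc (j) : G.Adj (f j) (f (j + 1)) := (hadj _ _).2 (Or.inr rfl)
  have hne_two (j) : f j ≠ f (j + 2) := fun h => h2 (by linear_combination -(hinj h))
  have hnadj_two (j) : ¬ G.Adj (f j) (f (j + 2)) := by
    rw [hadj]
    rintro (h | h)
    · exact h3 (by linear_combination -h)
    · exact h1 (by linear_combination h)
  have hnadj_three (j) : ¬ G.Adj (f j) (f (j + 3)) := by
    rw [hadj]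
    rintro (h | h)
    · exact h4 (by linear_combination -h)
    · exact h2 (by linear_combination h)
  have hnot_both (j) (hj : G.Adj u (f j)) : ¬ G.Adj u (f (j + 2)) := fun hj2 =>
    hclaw (containsInduced_claw hj hj2 huw (hne_two j) (hwne _) (hwne _)
      (hnadj_two j) (hw' _) (hw' _))
  obtain ⟨j, hj1, hj2⟩ : ∃ j, G.Adj u (f (j + 1)) ∧ G.Adj u (f (j + 2)) := by
    obtain ⟨k, rfl⟩ : ∃ k, i = k + 1 := ⟨i - 1, by ring⟩
    have hk := hsucc (k + 1)
    rw [show k + 1 + 1 = k + 2 by ring] at hk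
    by_cases hk2 : G.Adj u (f (k + 2))
    · exact ⟨k, hi, hk2⟩
    by_cases hk0 : G.Adj u (f k)
    · refine ⟨k - 1, ?_, ?_⟩
      · rwa [show k - 1 + 1 = k by ring]
      · rwa [show k - 1 + 2 = k + 1 by ring]
    exact absurd (containsInduced_claw hi.symm (hsucc k).symm hk (hune _).symm (hune _).symm
      (hne_two k) hk0 hk2 (hnadj_two k)) hclaw
  have e2 : j + 1 + 1 = j + 2 := by ring
  have e3 : j + 2 + 1 = j + 3 := by ring
  have e3' : j + 1 + 2 = j + 3 := by ring
  have nu0 : ¬ G.Adj u (f j) := fun h => hnot_both j h hj2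
  have nu3 : ¬ G.Adj u (f (j + 3)) := e3' ▸ hnot_both (j + 1) hj1
  have h12 : G.Adj (f (j + 1)) (f (j + 2)) := e2 ▸ hsucc (j + 1)
  have h23 : G.Adj (f (j + 2)) (f (j + 3)) := e3 ▸ hsucc (j + 2)
  have n13 : ¬ G.Adj (f (j + 1)) (f (j + 3)) := e3' ▸ hnadj_two (j + 1)
  exact hnet (containsInduced_net h12 hj1.symm hj2.symm (hsucc j).symm h23 huw
    n13 (hw' _) (fun h => hnadj_two j h.symm) (hw' _) nu0 nu3 (hnadj_three j) (hw' _) (hw' _))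

/-- In a connected claw-free and net-free graph, every vertex lies
on or has a neighbor on every induced cycle of length at least 5
(i.e. the graph is `C_ℓ*`-free for all `ℓ ≥ 5`). -/
theorem claw_net_free_connected_no_long_cycle_star {V : Type*} [Fintype V]
    (G : SimpleGraph V) (hconn : G.Connected)
    (hclaw : ¬ ContainsInduced G clawG) (hnet : ¬ ContainsInduced G netG) :
    ∀ (ℓ : ℕ) (f : ZMod ℓ → V), 5 ≤ ℓ → IsInducedCycle G ℓ f →
      ∀ v : V, v ∈ Set.range f ∨ ∃ i : ZMod ℓ, G.Adj v (f i) := by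
  intro ℓ f hℓ hf v
  obtain ⟨p⟩ := hconn.preconnected (f 0) v
  have hp {a b : V} (p : G.Walk a b) (ha : a ∈ Set.range f ∨ ∃ i, G.Adj a (f i)) :
      b ∈ Set.range f ∨ ∃ i, G.Adj b (f i) := by
    induction p with
    | nil => exact ha
    | cons h _ ih => exact ih (exists_adj_inducedCycle_of_adj hclaw hnet hℓ hf ha h)
  exact hp p (Or.inl ⟨0, rfl⟩)
end

section
/- For every graph G, the following are equivalent: (i) G is a proper circular-arc graph and the complement of G is bipartite; (ii) the complement of G is a bipartite permutation graph. -/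
/-! ### Arcs of the unit circle -/

theorem circlePt_eq_iff (s t : ℝ) : circlePt s = circlePt t ↔ ∃ k : ℤ, s = t + k := by
  constructor
  · intro h
    simp only [circlePt, Prod.mk.injEq] at h
    have h' : ((2 * Real.pi * s : ℝ) : Real.Angle) = (2 * Real.pi * t : ℝ) :=
      Real.Angle.cos_sin_inj h.1 h.2
    obtain ⟨k, hk⟩ := Real.Angle.angle_eq_iff_two_pi_dvd_sub.1 h'
    refine ⟨k, ?_⟩
    have hpi := Real.pi_pos
    have : 2 * Real.pi * (s - (t + k)) = 0 := by linarith
    rcases mul_eq_zero.1 this with h0 | h0 <;> linarith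
  · rintro ⟨k, rfl⟩
    have : 2 * Real.pi * (t + k) = 2 * Real.pi * t + k * (2 * Real.pi) := by ring
    simp only [circlePt, this, Real.cos_add_int_mul_two_pi, Real.sin_add_int_mul_two_pi]

theorem circlePt_mem_image_Icc {t L R : ℝ} :
    circlePt t ∈ circlePt '' Set.Icc L R ↔ ∃ k : ℤ, L ≤ t + k ∧ t + k ≤ R := by
  constructor
  · rintro ⟨s, hs, hst⟩
    obtain ⟨k, rfl⟩ := (circlePt_eq_iff s t).1 hst
    exact ⟨k, hs.1, hs.2⟩
  · rintro ⟨k, h⟩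
    exact ⟨t + k, h, (circlePt_eq_iff _ _).2 ⟨k, rfl⟩⟩

theorem image_Icc_inter_nonempty {L R A B : ℝ} :
    (circlePt '' Set.Icc L R ∩ circlePt '' Set.Icc A B).Nonempty ↔
      ∃ t, L ≤ t ∧ t ≤ R ∧ ∃ k : ℤ, A ≤ t + k ∧ t + k ≤ B := by
  constructor
  · rintro ⟨_, ⟨t, ht, rfl⟩, h⟩
    exact ⟨t, ht.1, ht.2, circlePt_mem_image_Icc.1 h⟩
  · rintro ⟨t, h1, h2, h⟩
    exact ⟨circlePt t, ⟨t, ⟨h1, h2⟩, rfl⟩, circlePt_mem_image_Icc.2 h⟩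

theorem image_Icc_subset_of_shift {L R A B : ℝ} (k : ℤ) (hA : A ≤ L + k) (hB : R + k ≤ B) :
    circlePt '' Set.Icc L R ⊆ circlePt '' Set.Icc A B := by
  rintro _ ⟨t, ht, rfl⟩
  exact circlePt_mem_image_Icc.2 ⟨k, by linarith [ht.1], by linarith [ht.2]⟩

theorem image_Icc_add_int (L R : ℝ) (k : ℤ) :
    circlePt '' Set.Icc (L + k) (R + k) = circlePt '' Set.Icc L R := by
  apply Set.Subset.antisymm
  · exact image_Icc_subset_of_shift (-k) (by push_cast; linarith) (by push_cast; linarith)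
  · exact image_Icc_subset_of_shift k le_rfl le_rfl

theorem image_Icc_ssubset {L R A B : ℝ} (hLR : L ≤ R) (hAB : B - A < 1) (hL : A ≤ L) (hR : R ≤ B)
    (hne : A < L ∨ R < B) : circlePt '' Set.Icc L R ⊂ circlePt '' Set.Icc A B := by
  refine ⟨image_Icc_subset_of_shift 0 (by simpa) (by simpa), fun h => ?_⟩
  rcases hne with hne | hne
  · obtain ⟨k, h1, h2⟩ := circlePt_mem_image_Icc.1
      (h ⟨A, ⟨le_rfl, by linarith⟩, rfl⟩)
    have hk0 : (0 : ℝ) < k := by linarith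
    have hk1 : (k : ℝ) < 1 := by linarith
    norm_cast at hk0 hk1
    lia
  · obtain ⟨k, h1, h2⟩ := circlePt_mem_image_Icc.1
      (h ⟨B, ⟨by linarith, le_rfl⟩, rfl⟩)
    have hk0 : (k : ℝ) < 0 := by linarith
    have hk1 : ((-1 : ℤ) : ℝ) < k := by push_cast; linarith
    norm_cast at hk0 hk1
    lia

/-- If an arc meets `[l, r]` and does not properly contain the disjoint arc `[A, B]`, then it lifts
to an interval that is located near `[l, r]`. -/
theorem exists_lift_of_inter {l r A B : ℝ} (hrA : r < A) (hBl : B < l + 1)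
    {T : Set (ℝ × ℝ)} (hT : IsUnitCircleArc T) (hI : (T ∩ circlePt '' Set.Icc l r).Nonempty)
    (hJ : ¬ circlePt '' Set.Icc A B ⊂ T) :
    ∃ L R : ℝ, T = circlePt '' Set.Icc L R ∧ L ≤ R ∧ R - L < 1 ∧
      A - 1 < L ∧ L ≤ r ∧ l ≤ R ∧ R < B := by
  obtain ⟨p, q, h0, h1, rfl⟩ := hT
  obtain ⟨t, hpt, htq, k, hk1, hk2⟩ := image_Icc_inter_nonempty.1 hI
  have hnot : ¬ circlePt '' Set.Icc A B ⊆ circlePt '' Set.Icc p q := by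
    refine fun h => hJ ⟨h, fun h' => ?_⟩
    obtain ⟨m, hm1, hm2⟩ := circlePt_mem_image_Icc.1 (h' ⟨t, ⟨hpt, htq⟩, rfl⟩)
    have e1 : (k : ℝ) < m := by linarith
    have e2 : (m : ℝ) < k + 1 := by linarith
    norm_cast at e1 e2
    lia
  refine ⟨p + k, q + k, (image_Icc_add_int p q k).symm, by linarith, by linarith, ?_,
    by linarith, by linarith, ?_⟩
  · by_contra! h
    exact hnot (image_Icc_subset_of_shift (-1 - k) (by push_cast; linarith)
      (by push_cast; linarith))
  · by_contra! h
    exact hnot (image_Icc_subset_of_shift (-k) (by push_cast; linarith) (by push_cast; linarith))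

/-- Disjoint arcs have lifts that are disjoint within one period. -/
theorem exists_lift_of_disjoint {l r : ℝ} (hlr : l ≤ r) {T : Set (ℝ × ℝ)}
    (hT : IsUnitCircleArc T) (h : ¬ (circlePt '' Set.Icc l r ∩ T).Nonempty) :
    ∃ A B : ℝ, T = circlePt '' Set.Icc A B ∧ r < A ∧ A ≤ B ∧ B < l + 1 := by
  obtain ⟨p, q, h0, h1, rfl⟩ := hT
  have hp1 := Int.floor_le (p - l)
  have hp2 := Int.lt_floor_add_one (p - l)
  set k := ⌊p - l⌋
  rw [← image_Icc_add_int p q (-k), image_Icc_inter_nonempty] at h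
  push_cast at h
  refine ⟨p + -k, q + -k, ?_, ?_, by linarith, ?_⟩
  · exact_mod_cast (image_Icc_add_int p q (-k)).symm
  · by_contra! h'
    exact h ⟨p + -k, by linarith, h', 0, by simp; linarith⟩
  · by_contra! h'
    exact h ⟨l, le_rfl, hlr, 1, by push_cast; linarith, by push_cast; linarith⟩

/-! ### Permutation graphs from a pair of linear preorders -/

theorem exists_real_of_injective {V L : Type*} [Fintype V] [LinearOrder L] (κ : V → L)
    (hκ : Function.Injective κ) :
    ∃ a : V → ℝ, Function.Injective a ∧ ∀ u v, a u < a v ↔ κ u < κ v := by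
  have hmono : ∀ u v, κ u < κ v → (Finset.univ.filter (fun w => κ w < κ u)).card <
      (Finset.univ.filter (fun w => κ w < κ v)).card := by
    intro u v huv
    apply Finset.card_lt_card
    refine ⟨fun w hw => ?_, fun h => ?_⟩
    · simp only [Finset.mem_filter, Finset.mem_univ, true_and] at hw ⊢
      exact hw.trans huv
    · have := h (show u ∈ _ by simpa using huv)
      simp at this
  refine ⟨fun v => ((Finset.univ.filter (fun w => κ w < κ v)).card : ℝ), ?_, ?_⟩
  · intro u v h
    have h' : (Finset.univ.filter (fun w => κ w < κ u)).card =
      (Finset.univ.filter (fun w => κ w < κ v)).card := Nat.cast_injective (R := ℝ) h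
    rcases lt_trichotomy (κ u) (κ v) with h1 | h1 | h1
    · exact absurd h' (hmono u v h1).ne
    · exact hκ h1
    · exact absurd h' (hmono v u h1).ne'
  · intro u v
    simp only [Nat.cast_lt]
    refine ⟨fun h => ?_, hmono u v⟩
    rcases lt_trichotomy (κ u) (κ v) with h1 | h1 | h1
    · exact h1
    · rw [h1] at h
      exact absurd h (lt_irrefl _)
    · exact absurd h (hmono v u h1).not_gt

/-- Two real-valued keys, up to ties, describe a permutation graph with bipartition `c`. -/
theorem isPermutationGraph_of_keys {V : Type*} [Fintype V] (H : SimpleGraph V) (c : V → Bool)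
    (α β : V → ℝ) (hc : ∀ u v, H.Adj u v → c u ≠ c v)
    (hmono : ∀ u v, c u = c v → (α u < α v ↔ β u < β v))
    (hadj : ∀ x y, c x = true → c y = false → H.Adj x y → α x < α y ∧ β y < β x)
    (hnon : ∀ x y, c x = true → c y = false → ¬ H.Adj x y →
      (α y ≤ α x ∧ β y < β x) ∨ (α x < α y ∧ β x ≤ β y)) :
    IsPermutationGraph H := by
  let e := Fintype.equivFin V
  let κ₁ : V → ℝ ×ₗ (Bool ×ₗ Fin (Fintype.card V)) := fun v => toLex (α v, toLex (c v, e v))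
  let κ₂ : V → ℝ ×ₗ (Bool ×ₗ Fin (Fintype.card V)) := fun v => toLex (β v, toLex (!c v, e v))
  have i₁ : Function.Injective κ₁ := fun u v h => by
    simp only [κ₁, EmbeddingLike.apply_eq_iff_eq, Prod.mk.injEq] at h
    exact h.2.2
  have i₂ : Function.Injective κ₂ := fun u v h => by
    simp only [κ₂, EmbeddingLike.apply_eq_iff_eq, Prod.mk.injEq] at h
    exact h.2.2
  obtain ⟨a, ha, ha'⟩ := exists_real_of_injective κ₁ i₁
  obtain ⟨b, hb, hb'⟩ := exists_real_of_injective κ₂ i₂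
  have l₁ : ∀ u v, a u < a v ↔
      α u < α v ∨ (α u = α v ∧ (c u < c v ∨ (c u = c v ∧ e u < e v))) := by
    intro u v
    rw [ha']
    simp only [κ₁, Prod.Lex.toLex_lt_toLex]
  have l₂ : ∀ u v, b u < b v ↔
      β u < β v ∨ (β u = β v ∧ ((!c u) < (!c v) ∨ ((!c u) = (!c v) ∧ e u < e v))) := by
    intro u v
    rw [hb']
    simp only [κ₂, Prod.Lex.toLex_lt_toLex]
  have hsame : ∀ u v, c u = c v → a u < a v → b u < b v := by
    intro u v huv h
    have h1 := hmono u v huv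
    have h2 := hmono v u huv.symm
    rw [l₁] at h
    rw [l₂]
    simp only [huv, lt_irrefl, false_or, true_and] at h ⊢
    rcases h with h | ⟨h, h'⟩
    · exact Or.inl (h1.1 h)
    · refine Or.inr ⟨?_, h'⟩
      rcases lt_trichotomy (β u) (β v) with h3 | h3 | h3
      · linarith [h1.2 h3]
      · exact h3
      · linarith [h2.2 h3]
  have hcross : ∀ x y, c x = true → c y = false →
      ((H.Adj x y → a x < a y ∧ b y < b x) ∧
        (¬ H.Adj x y → (a y < a x ∧ b y < b x) ∨ (a x < a y ∧ b x < b y))) := by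
    intro x y hx hy
    simp only [l₁, l₂, hx, hy]
    refine ⟨fun h => ⟨Or.inl (hadj x y hx hy h).1, Or.inl (hadj x y hx hy h).2⟩, fun h => ?_⟩
    rcases hnon x y hx hy h with ⟨h1, h2⟩ | ⟨h1, h2⟩
    · refine Or.inl ⟨?_, Or.inl h2⟩
      rcases h1.lt_or_eq with h1 | h1
      · exact Or.inl h1
      · exact Or.inr ⟨h1, by simp⟩
    · refine Or.inr ⟨Or.inl h1, ?_⟩
      rcases h2.lt_or_eq with h2 | h2
      · exact Or.inl h2
      · exact Or.inr ⟨h2, by simp⟩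
  have hcross' : ∀ x y, c x = true → c y = false →
      (H.Adj x y ↔ (a x - a y) * (b x - b y) < 0) := by
    intro x y hx hy
    constructor
    · intro h
      obtain ⟨h1, h2⟩ := (hcross x y hx hy).1 h
      exact mul_neg_of_neg_of_pos (by linarith) (by linarith)
    · intro h
      by_contra h'
      rcases (hcross x y hx hy).2 h' with ⟨h1, h2⟩ | ⟨h1, h2⟩ <;> nlinarith
  refine ⟨a, b, ha, hb, fun u v huv => ?_⟩
  by_cases hcuv : c u = c v
  · refine ⟨fun h => absurd hcuv (hc u v h), fun h => ?_⟩
    rcases lt_trichotomy (a u) (a v) with h1 | h1 | h1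
    · have := hsame u v hcuv h1
      nlinarith
    · exact absurd (ha h1) huv
    · have := hsame v u hcuv.symm h1
      nlinarith
  · cases hu : c u <;> cases hv : c v
    · simp [hu, hv] at hcuv
    · rw [H.adj_comm, hcross' v u hv hu]
      ring_nf
    · exact hcross' u v hu hv
    · simp [hu, hv] at hcuv

/-- A bipartite graph whose edges are given by a pair of co-monotone keys is a permutation graph. -/
theorem isPermutationGraph_of_comonotone {V : Type*} [Fintype V] (H : SimpleGraph V)
    (c : V → Bool) (α β : V → ℝ) (hc : ∀ u v, H.Adj u v → c u ≠ c v)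
    (hmono : ∀ u v, c u = c v → (α u < α v ↔ β u < β v))
    (hadj : ∀ x y, c x = true → c y = false → (H.Adj x y ↔ α x < α y ∧ β y < β x)) :
    IsPermutationGraph H := by
  classical
  obtain ⟨M, hM⟩ : ∃ M, ∀ v, α v < M ∧ β v < M := by
    obtain ⟨M₁, h₁⟩ := Finite.bddAbove_range α
    obtain ⟨M₂, h₂⟩ := Finite.bddAbove_range β
    refine ⟨max M₁ M₂ + 1, fun v => ⟨?_, ?_⟩⟩
    · linarith [h₁ ⟨v, rfl⟩, le_max_left M₁ M₂]
    · linarith [h₂ ⟨v, rfl⟩, le_max_right M₁ M₂]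
  -- Isolated vertices are moved to the end of both orders.
  let I : V → Prop := fun v => ∀ w, ¬ H.Adj v w
  refine isPermutationGraph_of_keys H (fun v => if I v then true else c v)
    (fun v => if I v then M else α v) (fun v => if I v then M else β v) ?_ ?_ ?_ ?_
  · intro u v h
    have hu : ¬ I u := fun hI => hI v h
    have hv : ¬ I v := fun hI => hI u h.symm
    simpa only [hu, hv, if_false] using hc u v h
  · intro u v h
    by_cases hu : I u <;> by_cases hv : I v <;> simp only [hu, hv, if_true, if_false] at h ⊢
    · exact iff_of_false (hM v).1.not_gt (hM v).2.not_gt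
    · exact iff_of_true (hM u).1 (hM u).2
    · exact hmono u v h
  · intro x y hx hy h
    have hx' : ¬ I x := fun hI => hI y h
    have hy' : ¬ I y := fun hI => hI x h.symm
    simp only [hx', hy', if_false] at hx hy ⊢
    exact (hadj x y hx hy).1 h
  · intro x y hx hy h
    have hy' : ¬ I y := fun hI => by simp [hI] at hy
    by_cases hx' : I x
    · simp only [hx', hy', if_true, if_false]
      exact Or.inl ⟨(hM y).1.le, (hM y).2⟩
    · simp only [hx', hy', if_false] at hx hy ⊢
      rw [hadj x y hx hy] at h
      by_contra hcon
      obtain ⟨z, hz⟩ : ∃ z, H.Adj x z := by simpa [I] using hx'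
      have hcz : c z = false := by
        have := hc x z hz
        rw [hx] at this
        simpa using this.symm
      obtain ⟨h1, h2⟩ := (hadj x z hx hcz).1 hz
      have h3 := hmono y z (hy.trans hcz.symm)
      by_cases h4 : α x < α y
      · have h5 : β x ≤ β y := by
          by_contra h5
          exact h ⟨h4, not_le.1 h5⟩
        exact hcon (Or.inr ⟨h4, h5⟩)
      · have h5 : β x ≤ β y := by
          by_contra h5
          exact hcon (Or.inl ⟨not_lt.1 h4, not_le.1 h5⟩)
        have h6 : α y < α z := by linarith
        linarith [h3.1 h6]

/-! ### The two implications -/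

theorem right_lt_iff_left_lt_of_properFamily {V : Type*} {f : V → Set (ℝ × ℝ)} (hf : ProperFamily f)
    {L R : V → ℝ} {u v : V} (hu : f u = circlePt '' Set.Icc (L u) (R u))
    (hv : f v = circlePt '' Set.Icc (L v) (R v)) (huLR : L u ≤ R u) (hvLR : L v ≤ R v)
    (hu1 : R u - L u < 1) (hv1 : R v - L v < 1) : R u < R v ↔ L u < L v := by
  constructor
  · intro h
    by_contra! h'
    exact hf u v (hu ▸ hv ▸ image_Icc_ssubset huLR hv1 h' h.le (Or.inr h))
  · intro h
    by_contra! h'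
    exact hf v u (hu ▸ hv ▸ image_Icc_ssubset hvLR hu1 h.le h' (Or.inl h))

theorem isPermutationGraph_compl_of_properCircularArc {V : Type*} [Fintype V]
    (G : SimpleGraph V) (hG : IsProperCircularArcGraph G) (hb : IsBipartite Gᶜ) :
    IsPermutationGraph Gᶜ := by
  obtain ⟨f, ⟨harc, hrep⟩, hprop⟩ := hG
  obtain ⟨c, hc⟩ := hb
  by_cases hE : ∃ u v, Gᶜ.Adj u v
  swap
  · push Not at hE
    exact isPermutationGraph_of_comonotone Gᶜ (fun _ => true) (fun _ => 0) (fun _ => 0)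
      (fun u v h => absurd h (hE u v)) (fun _ _ _ => Iff.rfl) (fun _ _ _ h => by simp at h)
  obtain ⟨x₀, y₀, h₀⟩ := hE
  have hdisj : ∀ u v, u ≠ v → (Gᶜ.Adj u v ↔ ¬ (f u ∩ f v).Nonempty) := by
    intro u v huv
    rw [← hrep u v huv, SimpleGraph.compl_adj]
    simp [huv]
  have hself : ∀ v, (f v).Nonempty := by
    intro v
    obtain ⟨p, q, h, -, hpq⟩ := harc v
    rw [hpq]
    exact (Set.nonempty_Icc.2 (by linarith)).image _
  have hmeet : ∀ u v, c u = c v → (f u ∩ f v).Nonempty := by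
    intro u v h
    by_cases huv : u = v
    · subst huv
      simpa using hself u
    · by_contra h'
      exact hc u v ((hdisj u v huv).2 h') h
  obtain ⟨l, r, h0, h1, hI⟩ := harc x₀
  obtain ⟨A, B, hJ, hrA, hAB, hBl⟩ := exists_lift_of_disjoint (by linarith) (harc y₀)
    (hI ▸ (hdisj x₀ y₀ h₀.ne).1 h₀)
  have hI' : f x₀ = circlePt '' Set.Icc (l + 1) (r + 1) := by
    rw [hI]
    exact_mod_cast (image_Icc_add_int l r 1).symm
  have hlift : ∀ v, ∃ L R : ℝ, f v = circlePt '' Set.Icc L R ∧ L ≤ R ∧ R - L < 1 ∧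
      (c v = c x₀ → A - 1 < L ∧ L ≤ r ∧ l ≤ R ∧ R < B) ∧
      (c v ≠ c x₀ → l < L ∧ L ≤ B ∧ A ≤ R ∧ R < r + 1) := by
    intro v
    by_cases hv : c v = c x₀
    · obtain ⟨L, R, e, e1, e2, e3⟩ := exists_lift_of_inter hrA hBl (harc v)
        (hI ▸ hmeet v x₀ hv) (hJ ▸ hprop y₀ v)
      exact ⟨L, R, e, e1, e2, fun _ => e3, fun h => absurd hv h⟩
    · have hvy : c v = c y₀ := by
        have := hc x₀ y₀ h₀
        revert hv this
        cases c v <;> cases c x₀ <;> cases c y₀ <;> simp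
      obtain ⟨L, R, e, e1, e2, e3, e4⟩ := exists_lift_of_inter hBl (by linarith)
        (harc v) (hJ ▸ hmeet v y₀ hvy) (hI' ▸ hprop x₀ v)
      exact ⟨L, R, e, e1, e2, fun h => absurd h hv, fun _ => ⟨by linarith, e4⟩⟩
  choose L R hf hLR hRL hX hY using hlift
  have hnest : ∀ u v, R u < R v ↔ L u < L v := fun u v =>
    right_lt_iff_left_lt_of_properFamily hprop (hf u) (hf v) (hLR u) (hLR v) (hRL u) (hRL v)
  refine isPermutationGraph_of_comonotone Gᶜ (fun v => c v == c x₀)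
    (fun v => if c v = c x₀ then R v else L v) (fun v => if c v = c x₀ then L v else R v - 1)
    ?_ ?_ ?_
  · intro u v h
    have := hc u v h
    revert this
    cases c u <;> cases c v <;> cases c x₀ <;> simp
  · intro u v h
    have h' : (c u = c x₀) ↔ (c v = c x₀) := by
      rw [← beq_iff_eq, ← beq_iff_eq (a := c v)]
      exact Bool.eq_iff_iff.1 h
    by_cases hv : c v = c x₀
    · simp only [h'.2 hv, hv, if_true]
      exact hnest u v
    · simp only [mt h'.1 hv, hv, if_false, sub_lt_sub_iff_right]
      exact (hnest u v).symm
  · intro x y hx hy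
    replace hx : c x = c x₀ := by simpa using hx
    replace hy : c y ≠ c x₀ := by simpa using hy
    have hxy : x ≠ y := fun h => hy (h ▸ hx)
    obtain ⟨x1, x2, x3, x4⟩ := hX x hx
    obtain ⟨y1, y2, y3, y4⟩ := hY y hy
    rw [hdisj x y hxy, hf x, hf y, image_Icc_inter_nonempty]
    simp only [hx, hy, if_true, if_false]
    constructor
    · intro h
      constructor
      · by_contra! h'
        refine h ⟨max (L x) (L y), le_max_left _ _, max_le (hLR x) h', 0, ?_, ?_⟩
        · simp
        · simpa using ⟨by linarith, hLR y⟩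
      · by_contra! h'
        refine h ⟨max (L x) (L y - 1), le_max_left _ _, max_le (hLR x) (by linarith), 1, ?_, ?_⟩
        · push_cast
          linarith [le_max_right (L x) (L y - 1)]
        · push_cast
          have : max (L x) (L y - 1) ≤ R y - 1 := max_le h' (by linarith [hLR y])
          linarith
    · rintro ⟨h1, h2⟩ ⟨t, t1, t2, k, k1, k2⟩
      have e1 : (0 : ℝ) < k := by linarith
      have e2 : (k : ℝ) < 1 := by linarith
      norm_cast at e1 e2
      lia

theorem isProperCircularArcGraph_of_compl {V : Type*} (G : SimpleGraph V)
    (h : IsBipartitePermutationGraph Gᶜ) : IsProperCircularArcGraph G := by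
  classical
  obtain ⟨⟨a₀, b₀, ha₀, hb₀, hadj₀⟩, c, hc⟩ := h
  obtain ⟨a, ha, ha1, ha2⟩ : ∃ a : V → ℝ, (∀ u v, a u < a v ↔ a₀ u < a₀ v) ∧
      (∀ v, 0 < a v) ∧ ∀ v, a v < 1 / 4 :=
    ⟨fun v => Real.sigmoid (a₀ v) / 4, fun u v => by
      rw [div_lt_div_iff_of_pos_right (by norm_num), Real.sigmoid_strictMono.lt_iff_lt],
      fun v => by have := Real.sigmoid_pos (a₀ v); linarith,
      fun v => by have := Real.sigmoid_lt_one (a₀ v); linarith⟩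
  obtain ⟨b, hb, hb1, hb2⟩ : ∃ b : V → ℝ, (∀ u v, b u < b v ↔ b₀ u < b₀ v) ∧
      (∀ v, 0 < b v) ∧ ∀ v, b v < 1 / 4 :=
    ⟨fun v => Real.sigmoid (b₀ v) / 4, fun u v => by
      rw [div_lt_div_iff_of_pos_right (by norm_num), Real.sigmoid_strictMono.lt_iff_lt],
      fun v => by have := Real.sigmoid_pos (b₀ v); linarith,
      fun v => by have := Real.sigmoid_lt_one (b₀ v); linarith⟩
  have hadj : ∀ u v, Gᶜ.Adj u v ↔ (a u < a v ∧ b v < b u) ∨ (a v < a u ∧ b u < b v) := by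
    intro u v
    by_cases huv : u = v
    · subst huv
      simp
    · rw [hadj₀ u v huv, mul_neg_iff, ha, ha, hb, hb]
      simp only [sub_pos, sub_neg]
      tauto
  have hinj : ∀ u v, u ≠ v → (a u < a v ∨ a v < a u) ∧ (b u < b v ∨ b v < b u) := by
    intro u v huv
    rw [ha, ha, hb, hb]
    exact ⟨lt_or_gt_of_ne (ha₀.ne huv), lt_or_gt_of_ne (hb₀.ne huv)⟩
  let X : V → Prop := fun v => ∃ w, a v < a w ∧ b w < b v
  have hXX : ∀ u v, X u → X v → a u < a v → b u < b v := by
    rintro u v - ⟨w, h1, h2⟩ h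
    have huv : u ≠ v := fun e => h.ne (congrArg a e)
    rcases (hinj u v huv).2 with h' | h'
    · exact h'
    · have c1 := hc u v ((hadj u v).2 (Or.inl ⟨h, h'⟩))
      have c2 := hc v w ((hadj v w).2 (Or.inl ⟨h1, h2⟩))
      have c3 := hc u w ((hadj u w).2 (Or.inl ⟨h.trans h1, h2.trans h'⟩))
      revert c1 c2 c3
      cases c u <;> cases c v <;> cases c w <;> simp
  have hYY : ∀ u v, ¬ X u → ¬ X v → a u < a v → b u < b v := by
    intro u v hu _ h
    have huv : u ≠ v := fun e => h.ne (congrArg a e)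
    rcases (hinj u v huv).2 with h' | h'
    · exact h'
    · exact absurd ⟨v, h, h'⟩ hu
  have hXY : ∀ x y, X x → ¬ X y → (Gᶜ.Adj x y ↔ a x < a y ∧ b y < b x) := by
    intro x y _ hy
    rw [hadj]
    exact ⟨fun h => h.resolve_right fun h => hy ⟨x, h⟩, Or.inl⟩
  let f : V → Set (ℝ × ℝ) := fun v =>
    if X v then circlePt '' Set.Icc (b v) (1 / 2 + a v)
    else circlePt '' Set.Icc (1 / 2 + a v) (1 + b v)
  have fX : ∀ v, X v → f v = circlePt '' Set.Icc (b v) (1 / 2 + a v) := fun v h => if_pos h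
  have fY : ∀ v, ¬ X v → f v = circlePt '' Set.Icc (1 / 2 + a v) (1 + b v) := fun v h => if_neg h
  have hint : ∀ k : ℤ, ¬ ((0 : ℝ) < k ∧ (k : ℝ) < 1) := by
    rintro k ⟨h1, h2⟩
    norm_cast at h1 h2
    lia
  have hGadj : ∀ u v, u ≠ v → (G.Adj u v ↔ ¬ Gᶜ.Adj u v) := by
    intro u v huv
    simp [SimpleGraph.compl_adj, huv]
  have hcross : ∀ x y, X x → ¬ X y → (G.Adj x y ↔ (f x ∩ f y).Nonempty) := by
    intro x y hx hy
    have hxy : x ≠ y := fun e => hy (e ▸ hx)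
    rw [hGadj x y hxy, hXY x y hx hy, fX x hx, fY y hy, image_Icc_inter_nonempty]
    have := ha1 x; have := ha2 x; have := hb1 x; have := hb2 x
    have := ha1 y; have := ha2 y; have := hb1 y; have := hb2 y
    constructor
    · intro h
      by_cases h' : a x < a y
      · have h'' : b x ≤ b y := by
          by_contra! h''
          exact h ⟨h', h''⟩
        exact ⟨b x, le_rfl, by linarith, 1, by push_cast; linarith, by push_cast; linarith⟩
      · exact ⟨1 / 2 + a x, by linarith, le_rfl, 0, by push_cast; linarith, by push_cast; linarith⟩
    · rintro ⟨t, t1, t2, k, k1, k2⟩ ⟨h1, h2⟩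
      exact hint k ⟨by linarith, by linarith⟩
  have hsame : ∀ u v, (X u ↔ X v) → u ≠ v → (G.Adj u v ↔ (f u ∩ f v).Nonempty) := by
    intro u v huv hne
    have := ha1 u; have := ha2 u; have := hb1 u; have := hb2 u
    have := ha1 v; have := ha2 v; have := hb1 v; have := hb2 v
    refine iff_of_true ?_ ?_
    · rw [hGadj u v hne, hadj]
      have h1 := hXX u v; have h2 := hXX v u; have h3 := hYY u v; have h4 := hYY v u
      rintro (⟨e1, e2⟩ | ⟨e1, e2⟩) <;> by_cases hv : X v
      · linarith [h1 (huv.2 hv) hv e1]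
      · linarith [h3 (mt huv.1 hv) hv e1]
      · linarith [h2 hv (huv.2 hv) e1]
      · linarith [h4 hv (mt huv.1 hv) e1]
    · by_cases hv : X v
      · rw [fX u (huv.2 hv), fX v hv, image_Icc_inter_nonempty]
        exact ⟨1 / 2, by linarith, by linarith, 0, by push_cast; linarith, by push_cast; linarith⟩
      · rw [fY u (mt huv.1 hv), fY v hv, image_Icc_inter_nonempty]
        exact ⟨1, by linarith, by linarith, 0, by push_cast; linarith, by push_cast; linarith⟩
  refine ⟨f, ⟨fun v => ?_, fun u v huv => ?_⟩, fun u v huv => ?_⟩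
  · have := ha1 v; have := ha2 v; have := hb1 v; have := hb2 v
    by_cases hv : X v
    · exact ⟨_, _, by linarith, by linarith, fX v hv⟩
    · exact ⟨_, _, by linarith, by linarith, fY v hv⟩
  · by_cases hu : X u <;> by_cases hv : X v
    · exact hsame u v (iff_of_true hu hv) huv
    · exact hcross u v hu hv
    · rw [G.adj_comm, Set.inter_comm]
      exact hcross v u hv hu
    · exact hsame u v (iff_of_false hu hv) huv
  · have hne : u ≠ v := fun e => by
      subst e
      exact (ssubset_irrefl _ huv).elim
    have hsub := huv.1
    have := ha1 u; have := ha2 u; have := hb1 u; have := hb2 u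
    have := ha1 v; have := ha2 v; have := hb1 v; have := hb2 v
    by_cases hu : X u <;> by_cases hv : X v
    · rw [fX u hu, fX v hv] at hsub
      rcases (hinj u v hne).1 with h | h
      · have h' := hXX u v hu hv h
        obtain ⟨k, k1, k2⟩ := circlePt_mem_image_Icc.1
          (hsub ⟨b u, ⟨le_rfl, by linarith⟩, rfl⟩)
        exact hint k ⟨by linarith, by linarith⟩
      · have h' := hXX v u hv hu h
        obtain ⟨k, k1, k2⟩ := circlePt_mem_image_Icc.1
          (hsub ⟨1 / 2 + a u, ⟨by linarith, le_rfl⟩, rfl⟩)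
        exact hint (k + 1) ⟨by push_cast; linarith, by push_cast; linarith⟩
    · rw [fX u hu, fY v hv] at hsub
      obtain ⟨k, k1, k2⟩ := circlePt_mem_image_Icc.1
        (hsub ⟨1 / 4, ⟨by linarith, by linarith⟩, rfl⟩)
      exact hint k ⟨by linarith, by linarith⟩
    · rw [fY u hu, fX v hv] at hsub
      obtain ⟨k, k1, k2⟩ := circlePt_mem_image_Icc.1
        (hsub ⟨3 / 4, ⟨by linarith, by linarith⟩, rfl⟩)
      exact hint (k + 1) ⟨by push_cast; linarith, by push_cast; linarith⟩
    · rw [fY u hu, fY v hv] at hsub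
      rcases (hinj u v hne).1 with h | h
      · have h' := hYY u v hu hv h
        obtain ⟨k, k1, k2⟩ := circlePt_mem_image_Icc.1
          (hsub ⟨1 / 2 + a u, ⟨le_rfl, by linarith⟩, rfl⟩)
        exact hint k ⟨by linarith, by linarith⟩
      · have h' := hYY v u hv hu h
        obtain ⟨k, k1, k2⟩ := circlePt_mem_image_Icc.1
          (hsub ⟨1 + b u, ⟨by linarith, le_rfl⟩, rfl⟩)
        exact hint (k + 1) ⟨by push_cast; linarith, by push_cast; linarith⟩

/-- `G` is a proper circular-arc graph with bipartite complement
iff the complement of `G` is a bipartite permutation graph. -/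
theorem pcag_co_bipartite_iff_compl_bipartite_permutation {V : Type*} [Fintype V]
    (G : SimpleGraph V) :
    (IsProperCircularArcGraph G ∧ IsBipartite Gᶜ) ↔ IsBipartitePermutationGraph Gᶜ :=
  ⟨fun h => ⟨isPermutationGraph_compl_of_properCircularArc G h.1 h.2, h.2⟩,
    fun h => ⟨isProperCircularArcGraph_of_compl G h, h.2⟩⟩
end

section
/- Let G be a graph with a clique circle K_1, …, K_ℓ, and suppose that no vertex of G belongs to all ℓ maximal cliques, so that for each vertex v the set of positions i (mod ℓ) with v ∈ K_i is a proper circular interval from lp(v) to rp(v). Assign to each vertex v the closed circular arc A_v of the circle ℝ/ℓℤ that runs clockwise from the point lp(v) to the point rp(v). Then this family of arcs is an arc representation of G: two distinct vertices u and v are adjacent in G if and only if A_u ∩ A_v ≠ ∅. -/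
/-- In a finite graph, every clique is contained in a maximal one. -/
theorem exists_isMaxClique_superset {V : Type*} [Finite V] {G : SimpleGraph V} {s : Set V}
    (hs : G.IsClique s) : ∃ t, s ⊆ t ∧ IsMaxClique G t := by
  obtain ⟨t, hst, ht⟩ :=
    (Set.toFinite {t : Set V | G.IsClique t}).exists_le_maximal (a := s) hs
  exact ⟨t, hst, ht.prop, fun r hr htr => (ht.eq_of_subset hr htr).symm⟩

/-- Two vertices of a finite graph are adjacent iff they are distinct members of a common
maximal clique. -/
theorem adj_iff_exists_isMaxClique {V : Type*} [Finite V] {G : SimpleGraph V} {u v : V}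
    (huv : u ≠ v) : G.Adj u v ↔ ∃ s, IsMaxClique G s ∧ u ∈ s ∧ v ∈ s := by
  constructor
  · intro h
    obtain ⟨s, hs, hmax⟩ := exists_isMaxClique_superset
      (SimpleGraph.isClique_pair.2 fun _ => h)
    exact ⟨s, hmax, hs (by simp), hs (by simp)⟩
  · rintro ⟨s, hs, hu, hv⟩
    exact hs.1 hu hv huv

/-- Points with the same image in `ℝ/ℓℤ` have floors congruent modulo `ℓ`. -/
theorem AddCircle.floor_intCast_zmod_eq {ℓ : ℕ} {x y : ℝ}
    (h : (x : AddCircle (ℓ : ℝ)) = y) : ((⌊x⌋ : ℤ) : ZMod ℓ) = ((⌊y⌋ : ℤ) : ZMod ℓ) := by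
  obtain ⟨n, hn⟩ := AddSubgroup.mem_zmultiples_iff.1 (QuotientAddGroup.eq.1 h)
  obtain rfl : y = x + ((n * ℓ : ℤ) : ℝ) := by
    push_cast
    rw [zsmul_eq_mul] at hn
    linarith
  rw [Int.floor_add_intCast]
  simp

/-- A residue class lies in the circular interval of length `n` starting at `p` iff it has
an integer representative between `p` and `p + n`. -/
theorem ZMod.exists_eq_add_natCast_iff {ℓ : ℕ} (p : ℤ) (n : ℕ) (i : ZMod ℓ) :
    (∃ k : ℕ, k ≤ n ∧ i = (p : ZMod ℓ) + (k : ZMod ℓ)) ↔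
      ∃ m : ℤ, p ≤ m ∧ m ≤ p + n ∧ (m : ZMod ℓ) = i := by
  constructor
  · rintro ⟨k, hk, rfl⟩
    exact ⟨p + k, by omega, by omega, by push_cast; rfl⟩
  · rintro ⟨m, hm, hm', rfl⟩
    obtain ⟨k, rfl⟩ := Int.le.dest hm
    exact ⟨k, by omega, by push_cast; rfl⟩

/-- Given a clique circle `K_0, …, K_{ℓ-1}` of `G` in which no
vertex lies in all `ℓ` maximal cliques, so that the positions of the cliques
containing each vertex `v` form a proper circular interval from `lp v` to
`rp v = lp v + len v`, the closed arcs `A v` of the circle `ℝ/ℓℤ` running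
clockwise from `lp v` to `rp v` form an arc representation of `G`. -/
theorem clique_circle_gives_arc_rep {V : Type*} [Fintype V] (G : SimpleGraph V)
    (ℓ : ℕ) (hℓ : 0 < ℓ) (K : ZMod ℓ → Set V)
    (hinj : Function.Injective K)
    (hmax : ∀ i : ZMod ℓ, IsMaxClique G (K i))
    (hall : ∀ s : Set V, IsMaxClique G s → ∃ i : ZMod ℓ, K i = s)
    (lp : V → ℤ) (len : V → ℕ)
    (hproper : ∀ v : V, len v + 1 < ℓ)
    (hmem : ∀ (v : V) (i : ZMod ℓ),
      v ∈ K i ↔ ∃ k : ℕ, k ≤ len v ∧ i = (lp v : ZMod ℓ) + (k : ZMod ℓ))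
    (A : V → Set (AddCircle (ℓ : ℝ)))
    (hA : ∀ v : V, A v =
      (fun x : ℝ => (x : AddCircle (ℓ : ℝ))) '' Set.Icc (lp v : ℝ) ((lp v : ℝ) + (len v : ℝ))) :
    ∀ u v : V, u ≠ v → (G.Adj u v ↔ (A u ∩ A v).Nonempty) := by
  intro u v huv
  rw [adj_iff_exists_isMaxClique huv, hA, hA]
  simp only [ZMod.exists_eq_add_natCast_iff] at hmem
  constructor
  · rintro ⟨s, hs, hu, hv⟩
    obtain ⟨i, rfl⟩ := hall s hs
    obtain ⟨a, hua, hau, rfl⟩ := (hmem u i).1 hu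
    obtain ⟨b, hvb, hbv, hba⟩ := (hmem v _).1 hv
    obtain ⟨n, hn⟩ := (ZMod.intCast_eq_intCast_iff_dvd_sub _ _ _).1 hba
    refine ⟨((a : ℝ) : AddCircle (ℓ : ℝ)), ⟨a, ⟨mod_cast hua, mod_cast hau⟩, rfl⟩,
      ⟨b, ⟨mod_cast hvb, mod_cast hbv⟩, ?_⟩⟩
    refine QuotientAddGroup.eq.2 (AddSubgroup.mem_zmultiples_iff.2 ⟨n, ?_⟩)
    have hn' : (a : ℝ) - b = ℓ * n := mod_cast hn
    rw [zsmul_eq_mul]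
    linarith
  · rintro ⟨_, ⟨x, ⟨hux, hxu⟩, rfl⟩, ⟨y, ⟨hvy, hyv⟩, hyx⟩⟩
    refine ⟨K (⌊x⌋ : ℤ), hmax _, (hmem u _).2 ⟨⌊x⌋, Int.le_floor.2 hux, ?_, rfl⟩,
      (hmem v _).2 ⟨⌊y⌋, Int.le_floor.2 hvy, ?_, AddCircle.floor_intCast_zmod_eq hyx⟩⟩
    · exact_mod_cast (Int.floor_le x).trans hxu
    · exact_mod_cast (Int.floor_le y).trans hyv
end

section
/- Every reduced graph R is C_ℓ*-free for every ℓ ≥ 7; equivalently, for every induced cycle C of R of length at least 7 and every vertex v of R, either v lies on C or v has a neighbor on C. -/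
/-- In a graph without false twins, preservation of adjacency forces injectivity. -/
theorem containsInduced_of_adj_iff {V W : Type*} {G : SimpleGraph V} {H : SimpleGraph W}
    (hH : ∀ u v, (∀ w, H.Adj u w ↔ H.Adj v w) → u = v) (f : W → V)
    (hf : ∀ u v, H.Adj u v ↔ G.Adj (f u) (f v)) : ContainsInduced G H :=
  ⟨f, fun u v huv => hH u v fun w => by rw [hf, hf, huv], hf⟩

theorem IsInducedCycle.adj_add_natCast {V : Type*} {G : SimpleGraph V} {ℓ : ℕ}
    {f : ZMod ℓ → V} (hf : IsInducedCycle G ℓ f) (i : ZMod ℓ) {a b : ℕ}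
    (ha : a + 1 < ℓ) (hb : b + 1 < ℓ) :
    G.Adj (f (i + a)) (f (i + b)) ↔ a = b + 1 ∨ b = a + 1 := by
  have key : ∀ {c d : ℕ}, c + 1 < ℓ → d + 1 < ℓ →
      (i + (c : ZMod ℓ) = i + (d : ZMod ℓ) + 1 ↔ c = d + 1) := by
    intro c d hc hd
    rw [add_assoc, add_right_inj, ← Nat.cast_succ, ZMod.natCast_eq_natCast_iff',
      Nat.mod_eq_of_lt (by omega), Nat.mod_eq_of_lt (by omega)]
  rw [hf.2.2, key ha hb, key hb ha]

/-- Five consecutive vertices of a long induced cycle induce a path. -/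
theorem IsInducedCycle.adj_window {V : Type*} {G : SimpleGraph V} {ℓ : ℕ}
    {f : ZMod ℓ → V} (hf : IsInducedCycle G ℓ f) (hℓ : 7 ≤ ℓ) (i : ZMod ℓ) :
    G.Adj (f i) (f (i + 1)) ∧ G.Adj (f (i + 1)) (f (i + 2)) ∧
      G.Adj (f (i + 2)) (f (i + 3)) ∧ G.Adj (f (i + 3)) (f (i + 4)) ∧
      ¬ G.Adj (f i) (f (i + 2)) ∧ ¬ G.Adj (f i) (f (i + 3)) ∧ ¬ G.Adj (f i) (f (i + 4)) ∧
      ¬ G.Adj (f (i + 1)) (f (i + 3)) ∧ ¬ G.Adj (f (i + 1)) (f (i + 4)) ∧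
      ¬ G.Adj (f (i + 2)) (f (i + 4)) := by
  have h : ∀ a b : ℕ, a < 5 → b < 5 →
      (G.Adj (f (i + a)) (f (i + b)) ↔ a = b + 1 ∨ b = a + 1) := fun a b ha hb =>
    hf.adj_add_natCast i (by omega) (by omega)
  have h01 := h 0 1
  have h12 := h 1 2
  have h23 := h 2 3
  have h34 := h 3 4
  have h02 := h 0 2
  have h03 := h 0 3
  have h04 := h 0 4
  have h13 := h 1 3
  have h14 := h 1 4
  have h24 := h 2 4
  norm_num at h01 h12 h23 h34 h02 h03 h04 h13 h14 h24
  exact ⟨h01, h12, h23, h34, h02, h03, h04, h13, h14, h24⟩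

theorem hasCycleStar_three {V : Type*} {G : SimpleGraph V} {a b c v : V}
    (hab : G.Adj a b) (hbc : G.Adj b c) (hac : G.Adj a c)
    (ha : ¬ G.Adj v a) (hb : ¬ G.Adj v b) (hc : ¬ G.Adj v c) : HasCycleStar G 3 := by
  let g : Fin 3 → V := ![a, b, c]
  have hadj : ∀ i j : Fin 3, G.Adj (g i) (g j) ↔ (i = j + 1 ∨ j = i + 1) := by
    intro i j
    fin_cases i <;> fin_cases j <;>
      simp [g, hab, hbc, hac, hab.symm, hbc.symm, hac.symm]
  have hinj : Function.Injective g := by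
    intro i j hij
    by_contra hne
    have h : G.Adj (g i) (g j) := (hadj i j).2 (by clear hij; revert i j; decide)
    exact h.ne hij
  refine ⟨g, v, ⟨le_rfl, hinj, hadj⟩, fun i : Fin 3 => ?_⟩
  fin_cases i <;> simp [g, ha, hb, hc]

instance : DecidableRel compC4star.Adj := by
  unfold compC4star; infer_instance

theorem containsInduced_compC4star {V : Type*} {G : SimpleGraph V} {a b c d e : V}
    (h02 : G.Adj a c) (h04 : G.Adj a e) (h13 : G.Adj b d) (h14 : G.Adj b e) (h24 : G.Adj c e)
    (h34 : G.Adj d e) (h01 : ¬ G.Adj a b) (h03 : ¬ G.Adj a d) (h12 : ¬ G.Adj b c)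
    (h23 : ¬ G.Adj c d) :
    ContainsInduced G compC4star := by
  refine containsInduced_of_adj_iff (by decide)
    ![a, b, c, d, e] fun u v => ?_
  fin_cases u <;> fin_cases v <;>
    simp [compC4star, *] <;> (rw [G.adj_comm]; assumption)

instance : DecidableRel F1G.Adj := by
  unfold F1G; infer_instance

theorem containsInduced_F1G {V : Type*} {G : SimpleGraph V} {a b c d e u w : V}
    (h01 : G.Adj a b) (h03 : G.Adj a d) (h05 : G.Adj a u) (h12 : G.Adj b c) (h34 : G.Adj d e)
    (h56 : G.Adj u w) (h02 : ¬ G.Adj a c) (h04 : ¬ G.Adj a e) (h06 : ¬ G.Adj a w)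
    (h13 : ¬ G.Adj b d) (h14 : ¬ G.Adj b e) (h15 : ¬ G.Adj b u) (h16 : ¬ G.Adj b w)
    (h23 : ¬ G.Adj c d) (h24 : ¬ G.Adj c e) (h25 : ¬ G.Adj c u) (h26 : ¬ G.Adj c w)
    (h35 : ¬ G.Adj d u) (h36 : ¬ G.Adj d w) (h45 : ¬ G.Adj e u) (h46 : ¬ G.Adj e w) :
    ContainsInduced G F1G := by
  refine containsInduced_of_adj_iff (by decide)
    ![a, b, c, d, e, u, w] fun u v => ?_
  fin_cases u <;> fin_cases v <;>
    simp [F1G, *] <;> (rw [G.adj_comm]; assumption)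

instance : DecidableRel F2G.Adj := by
  unfold F2G; infer_instance

theorem containsInduced_F2G {V : Type*} {G : SimpleGraph V} {a b c u d e w : V}
    (h01 : G.Adj a b) (h03 : G.Adj a u) (h04 : G.Adj a d) (h12 : G.Adj b c) (h23 : G.Adj c u)
    (h25 : G.Adj c e) (h36 : G.Adj u w) (h02 : ¬ G.Adj a c) (h05 : ¬ G.Adj a e)
    (h06 : ¬ G.Adj a w) (h13 : ¬ G.Adj b u) (h14 : ¬ G.Adj b d) (h15 : ¬ G.Adj b e)
    (h16 : ¬ G.Adj b w) (h24 : ¬ G.Adj c d) (h26 : ¬ G.Adj c w) (h34 : ¬ G.Adj u d)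
    (h35 : ¬ G.Adj u e) (h45 : ¬ G.Adj d e) (h46 : ¬ G.Adj d w) (h56 : ¬ G.Adj e w) :
    ContainsInduced G F2G := by
  refine containsInduced_of_adj_iff (by decide)
    ![a, b, c, u, d, e, w] fun u v => ?_
  fin_cases u <;> fin_cases v <;>
    simp [F2G, *] <;> (rw [G.adj_comm]; assumption)

/-- A reduced graph is `C_ℓ*`-free for every `ℓ ≥ 7`:
for every induced cycle of length at least 7 and every vertex `v`, either `v`
lies on the cycle or `v` has a neighbor on it. -/
theorem reduced_no_long_cycle_star {V : Type*} [Fintype V] (R : SimpleGraph V)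
    (hR : IsReducedGraph R) :
    ∀ (ℓ : ℕ) (f : ZMod ℓ → V), 7 ≤ ℓ → IsInducedCycle R ℓ f →
      ∀ v : V, v ∈ Set.range f ∨ ∃ i : ZMod ℓ, R.Adj v (f i) := by
  obtain ⟨hconn, -, hC3, -, hC4, -, -, -, hF1, hF2, -, -⟩ := hR
  intro ℓ f hℓ hf v
  by_contra hv
  obtain ⟨p⟩ := hconn.preconnected v (f 0)
  obtain ⟨d, -, hd₁, hd₂⟩ := p.exists_boundary_dart
    {x | ¬ (x ∈ Set.range f ∨ ∃ i, R.Adj x (f i))} hv (by simp)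
  obtain ⟨⟨w, u⟩, hwu⟩ := d
  simp only [Set.mem_ofPred_eq, not_not] at hd₁ hd₂ hwu
  obtain ⟨-, hw⟩ := not_or.1 hd₁
  replace hw : ∀ i, ¬ R.Adj (f i) w := fun i h => hw ⟨i, h.symm⟩
  have hu : ∃ i, R.Adj (f i) u := by
    rcases hd₂ with ⟨i, rfl⟩ | ⟨i, hi⟩
    · exact (hw i hwu.symm).elim
    · exact ⟨i, hi.symm⟩
  have hone : ∀ i, R.Adj (f i) u → ¬ R.Adj (f (i + 1)) u := by
    intro i h0 h1
    obtain ⟨h01, h12, h23, h34, h02, h03, h04, h13, h14, h24⟩ := hf.adj_window hℓ i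
    by_cases h3 : R.Adj (f (i + 3)) u
    · by_cases h4 : R.Adj (f (i + 4)) u
      · exact hC4 (containsInduced_compC4star h01 h0 h34 h3 h1 h4 h03 h04
          (fun h => h13 h.symm) h14)
      · exact hC3 (hasCycleStar_three h01 h1 h0 (fun h => h04 h.symm) (fun h => h14 h.symm) h4)
    · exact hC3 (hasCycleStar_three h01 h1 h0 (fun h => h03 h.symm) (fun h => h13 h.symm) h3)
  have htwo : ∀ i, R.Adj (f i) u → ¬ R.Adj (f (i + 2)) u := by
    intro i h0 h2
    obtain ⟨j, rfl⟩ : ∃ j, i = j + 1 := ⟨i - 1, by ring⟩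
    have e2 : j + 1 + 1 = j + 2 := by ring
    have e3 : j + 1 + 2 = j + 3 := by ring
    have e4 : j + 3 + 1 = j + 4 := by ring
    have hj : ¬ R.Adj (f j) u := fun h => hone j h h0
    have hj2 := hone _ h0
    have hj4 := hone _ h2
    rw [e3] at h2
    rw [e3, e4] at hj4
    rw [e2] at hj2
    obtain ⟨h01, h12, h23, h34, h02, h03, h04, h13, h14, h24⟩ := hf.adj_window hℓ j
    exact hF2 (containsInduced_F2G h12 h0 h01.symm h23 h2 h34 hwu.symm h13 h14 (hw _) hj2
      (fun h => h02 h.symm) h24 (hw _) (fun h => h03 h.symm) (hw _) (fun h => hj h.symm)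
      (fun h => hj4 h.symm) h04 (hw _) (hw _))
  obtain ⟨i, hi⟩ := hu
  obtain ⟨j, rfl⟩ : ∃ j, i = j + 2 := ⟨i - 2, by ring⟩
  have e1 : j + 1 + 1 = j + 2 := by ring
  have e3 : j + 2 + 1 = j + 3 := by ring
  have e4 : j + 2 + 2 = j + 4 := by ring
  have hj0 : ¬ R.Adj (f j) u := fun h => htwo j h hi
  have hj1 : ¬ R.Adj (f (j + 1)) u := fun h => hone _ h (by rwa [e1])
  have hj3 := hone _ hi
  have hj4 := htwo _ hi
  rw [e3] at hj3
  rw [e4] at hj4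
  obtain ⟨h01, h12, h23, h34, h02, h03, h04, h13, h14, h24⟩ := hf.adj_window hℓ j
  exact hF1 (containsInduced_F1G h12.symm h23 hi h01.symm h34 hwu.symm (fun h => h02 h.symm)
    h24 (hw _) h13 h14 hj1 (hw _) h03 h04 hj0 (hw _) hj3 (hw _) hj4 (hw _))
end
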